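/- Let n ≥ 2, let r > 0, and let Σ be a compact smooth embedded (n−1)-dimensional submanifold of ℝ^n contained in the open ball of radius r about the origin, with A(Σ) > 0. Let L^n_r denote the set of lines (v,p) with v ∈ S^{n−1}, p ∈ v^⊥, ‖p‖ < r, with kinematic measure μ, and let ℓ_1, ℓ_2, … be a sequence in L^n_r. Let f : ℝ^n → ℝ be continuous. Assume that (1/m)·Σ_{i=1}^m f^Σ(ℓ_i) → (1/μ(L^n_r))·∫_{L^n_r} f^Σ dμ and (1/m)·Σ_{i=1}^m #(ℓ_i ∩ Σ) → (1/μ(L^n_r))·∫_{L^n_r} #(ℓ ∩ Σ) dμ(ℓ) as m → ∞. Then lim_{m→∞} ( Σ_{i=1}^m f^Σ(ℓ_i) ) / ( Σ_{i=1}^m #(ℓ_i ∩ Σ) ) = (1/A(Σ)) · ∫_Σ f dH^{n−1}; that is, the intersection points of the lines with Σ sample f with average converging to the area-average of f over Σ. -/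

import Mathlib

open MeasureTheory Metric Set Filter
open scoped ENNReal RealInnerProductSpace Topology

noncomputable section

/-- The oriented line through `p` with direction `v`, i.e. `{t • v + p : t ∈ ℝ}`. -/
def lineThrough {n : ℕ} (v p : EuclideanSpace ℝ (Fin n)) : Set (EuclideanSpace ℝ (Fin n)) :=
  {x | ∃ t : ℝ, x = t • v + p}

/-- A compact smooth embedded `(n-1)`-dimensional submanifold of `ℝⁿ`: a compact set which is
locally the regular zero set of a smooth real-valued function. -/
def IsCompactSmoothHypersurface {n : ℕ} (S : Set (EuclideanSpace ℝ (Fin n))) : Prop :=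
  IsCompact S ∧ ∀ x ∈ S, ∃ U : Set (EuclideanSpace ℝ (Fin n)), IsOpen U ∧ x ∈ U ∧
    ∃ f : EuclideanSpace ℝ (Fin n) → ℝ, ContDiff ℝ (⊤ : ℕ∞) f ∧
      (∀ y ∈ U, fderiv ℝ f y ≠ 0) ∧ S ∩ U = {y | y ∈ U ∧ f y = 0}

/-- The kinematic measure on the space of oriented lines in `ℝⁿ`, identified with pairs `(v,p)`
with `v` in the unit sphere and `p ∈ v^⊥`. -/
def kinematicMeasure (n : ℕ) :
    Measure (EuclideanSpace ℝ (Fin n) × EuclideanSpace ℝ (Fin n)) :=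
  Measure.bind ((μH[(n : ℝ) - 1]).restrict (sphere (0 : EuclideanSpace ℝ (Fin n)) 1))
    (fun v => Measure.map (fun p => (v, p))
      ((μH[(n : ℝ) - 1]).restrict {p : EuclideanSpace ℝ (Fin n) | ⟪p, v⟫ = 0}))

open scoped Classical in
/-- `f^Σ(v,p)`: the sum of the values of `f` over the points of `ℓ(v,p) ∩ Σ` when this
intersection is finite, and `0` otherwise. -/
def lineSum {n : ℕ} (S : Set (EuclideanSpace ℝ (Fin n))) (f : EuclideanSpace ℝ (Fin n) → ℝ)
    (v p : EuclideanSpace ℝ (Fin n)) : ℝ :=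
  if h : (lineThrough v p ∩ S).Finite then ∑ x ∈ h.toFinset, f x else 0


abbrev EE (d : ℕ) := EuclideanSpace ℝ (Fin (d + 1))
abbrev FF (d : ℕ) := EuclideanSpace ℝ (Fin d)

instance factFinrankEE (d : ℕ) : Fact (Module.finrank ℝ (EE d) = d + 1) := ⟨by simp⟩

def baseVec (d : ℕ) : EE d := EuclideanSpace.single 0 1

lemma norm_baseVec (d : ℕ) : ‖baseVec d‖ = 1 := by simp [baseVec]

lemma baseVec_ne (d : ℕ) : baseVec d ≠ 0 := by
  intro h; have := norm_baseVec d; rw [h] at this; simp at this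

def baseJ (d : ℕ) : FF d →ₗᵢ[ℝ] EE d :=
  ((ℝ ∙ (baseVec d))ᗮ).subtypeₗᵢ.comp
    (OrthonormalBasis.fromOrthogonalSpanSingleton (𝕜 := ℝ) d (baseVec_ne d)).repr.symm.toLinearIsometry

lemma baseJ_inner {d : ℕ} (p : FF d) : ⟪baseJ d p, baseVec d⟫ = 0 := by
  have h : baseJ d p ∈ (ℝ ∙ (baseVec d))ᗮ := Subtype.property _
  rw [real_inner_comm]
  exact Submodule.mem_orthogonal_singleton_iff_inner_right.1 h

lemma baseJ_surj {d : ℕ} (x : EE d) (hx : ⟪x, baseVec d⟫ = 0) : ∃ p, baseJ d p = x := by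
  have h : x ∈ (ℝ ∙ (baseVec d))ᗮ := by
    rw [real_inner_comm] at hx
    exact Submodule.mem_orthogonal_singleton_iff_inner_right.2 hx
  refine ⟨(OrthonormalBasis.fromOrthogonalSpanSingleton (𝕜 := ℝ) d (baseVec_ne d)).repr ⟨x, h⟩, ?_⟩
  simp [baseJ]

def reflV {d : ℕ} (v : EE d) : EE d ≃ₗᵢ[ℝ] EE d := (ℝ ∙ (v - baseVec d))ᗮ.reflection

lemma reflV_apply {d : ℕ} (v x : EE d) : reflV v x =
    x - (2 * (⟪v - baseVec d, x⟫ / (‖v - baseVec d‖ ^ 2))) • (v - baseVec d) := by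
  rw [reflV, Submodule.reflection_orthogonal_apply, Submodule.reflection_singleton_apply]
  simp only [neg_sub, RCLike.ofReal_real_eq_id, id]
  rw [two_smul, ← add_smul, ← two_mul]

lemma reflV_self {d : ℕ} (v : EE d) (hv : ‖v‖ = 1) : reflV v v = baseVec d := by
  rw [reflV]
  exact Submodule.reflection_sub (by rw [hv, norm_baseVec])

lemma reflV_reflV {d : ℕ} (v x : EE d) : reflV v (reflV v x) = x := by
  simp [reflV]

lemma reflV_base {d : ℕ} (v : EE d) (hv : ‖v‖ = 1) : reflV v (baseVec d) = v := by
  rw [← reflV_self v hv, reflV_reflV]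

def Jv {d : ℕ} (v : EE d) : FF d →ₗᵢ[ℝ] EE d := (reflV v).toLinearIsometry.comp (baseJ d)

def Pv {d : ℕ} (v : EE d) : EE d →L[ℝ] FF d :=
  ContinuousLinearMap.adjoint (Jv v).toContinuousLinearMap

lemma Pv_inner {d : ℕ} (v : EE d) (x : EE d) (p : FF d) : ⟪Pv v x, p⟫ = ⟪x, Jv v p⟫ := by
  rw [Pv, ContinuousLinearMap.adjoint_inner_left]; rfl

lemma Jv_inner {d : ℕ} (v : EE d) (hv : ‖v‖ = 1) (p : FF d) : ⟪Jv v p, v⟫ = 0 := by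
  have : ⟪reflV v (baseJ d p), reflV v (baseVec d)⟫ = 0 := by
    rw [LinearIsometryEquiv.inner_map_map, baseJ_inner]
  rwa [reflV_base v hv] at this

lemma Jv_surj {d : ℕ} (v : EE d) (hv : ‖v‖ = 1) (x : EE d) (hx : ⟪x, v⟫ = 0) :
    ∃ p, Jv v p = x := by
  obtain ⟨p, hp⟩ := baseJ_surj (reflV v x) (by
    rw [← reflV_self v hv, LinearIsometryEquiv.inner_map_map, hx])
  exact ⟨p, by change reflV v (baseJ d p) = x; rw [hp, reflV_reflV]⟩

lemma Pv_Jv {d : ℕ} (v : EE d) (p : FF d) : Pv v (Jv v p) = p := by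
  refine ext_inner_right ℝ fun q => ?_
  rw [Pv_inner, LinearIsometry.inner_map_map]

lemma Pv_self {d : ℕ} (v : EE d) (hv : ‖v‖ = 1) : Pv v v = 0 := by
  refine ext_inner_right ℝ fun q => ?_
  rw [Pv_inner, real_inner_comm, Jv_inner v hv, inner_zero_left]

lemma Jv_Pv {d : ℕ} (v : EE d) (hv : ‖v‖ = 1) (x : EE d) :
    Jv v (Pv v x) = x - ⟪x, v⟫ • v := by
  obtain ⟨p, hp⟩ := Jv_surj v hv (x - ⟪x, v⟫ • v) (by
    rw [inner_sub_left, inner_smul_left, real_inner_self_eq_norm_sq, hv]; simp)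
  have : Pv v (x - ⟪x, v⟫ • v) = Pv v x := by
    rw [map_sub, map_smul, Pv_self v hv]; simp
  rw [← this, ← hp, Pv_Jv]

lemma norm_Pv_sq {d : ℕ} (v : EE d) (hv : ‖v‖ = 1) (x : EE d) :
    ‖Pv v x‖ ^ 2 = ‖x‖ ^ 2 - ⟪x, v⟫ ^ 2 := by
  rw [← (Jv v).norm_map (Pv v x), Jv_Pv v hv, norm_sub_sq_real, inner_smul_right, norm_smul, hv]
  simp; ring

lemma norm_Pv_le {d : ℕ} (v : EE d) (hv : ‖v‖ = 1) (x : EE d) : ‖Pv v x‖ ≤ ‖x‖ := by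
  have := norm_Pv_sq v hv x
  exact abs_le_of_sq_le_sq' (by nlinarith [sq_nonneg ⟪x, v⟫]) (norm_nonneg _) |>.2

lemma measurable_Jv (d : ℕ) : Measurable (fun z : EE d × FF d => Jv z.1 z.2) := by
  have : (fun z : EE d × FF d => Jv z.1 z.2) = fun z => reflV z.1 (baseJ d z.2) := rfl
  rw [this]
  simp_rw [reflV_apply]
  have h := (baseJ d).continuous.measurable
  fun_prop

/-- The linear map `ν^⊥ → v^⊥` given by projection. -/
def Tv {d : ℕ} (v w : EE d) : FF d →ₗ[ℝ] FF d :=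
  (Pv v).toLinearMap ∘ₗ (Jv w).toLinearMap

lemma Tv_apply {d : ℕ} (v w : EE d) (p : FF d) : Tv v w p = Pv v (Jv w p) := rfl

lemma det_Tv {d : ℕ} (v w : EE d) (hv : ‖v‖ = 1) (hw : ‖w‖ = 1) :
    |(Tv v w).det| = |⟪v, w⟫| := by
  have h1 : (Tv v w).adjoint ∘ₗ Tv v w =
      LinearMap.transvection (innerₛₗ ℝ (-(Pv w v))) (Pv w v) := by
    ext1 p
    refine ext_inner_right ℝ fun q => ?_
    rw [LinearMap.comp_apply, LinearMap.adjoint_inner_left]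
    simp only [Tv_apply, LinearMap.transvection, LinearMap.coe_mk, AddHom.coe_mk]
    rw [real_inner_comm, Pv_inner, Jv_Pv v hv, inner_sub_right, inner_smul_right,
      LinearIsometry.inner_map_map, innerₛₗ_apply_apply, inner_add_left, inner_smul_left,
      inner_neg_left, Pv_inner, Pv_inner, real_inner_comm v (Jv w q), real_inner_comm v (Jv w p),
      real_inner_comm p q]
    simp
    ring
  have h2 := congrArg LinearMap.det h1
  have h3 := LinearMap.normDet_sq (Tv v w)
  rw [LinearMap.normDet_eq_abs_det] at h3
  simp only [RCLike.ofReal_real_eq_id, id] at h3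
  rw [LinearMap.transvection.det, ← h3] at h2
  rw [sq_abs, innerₛₗ_apply_apply, inner_neg_left, real_inner_self_eq_norm_sq, norm_Pv_sq w hw, hv] at h2
  rw [← sq_eq_sq_iff_abs_eq_abs]
  simp at h2
  linarith

lemma Tv_lower {d : ℕ} (v w : EE d) (hv : ‖v‖ = 1) (hw : ‖w‖ = 1) (p : FF d) :
    |⟪v, w⟫| * ‖p‖ ≤ ‖Tv v w p‖ := by
  refine abs_le_of_sq_le_sq' ?_ (norm_nonneg _) |>.2
  rw [Tv_apply, norm_Pv_sq v hv, LinearIsometry.norm_map, mul_pow, sq_abs, real_inner_comm v (Jv w p),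
    ← Pv_inner]
  have h1 := norm_Pv_sq w hw v
  have h2 := real_inner_mul_inner_self_le (Pv w v) p
  rw [real_inner_self_eq_norm_sq, real_inner_self_eq_norm_sq, h1, hv] at h2
  nlinarith

instance haarFF (d : ℕ) : (μH[(d : ℝ)] : Measure (FF d)).IsAddHaarMeasure := by
  simpa using MeasureTheory.isAddHaarMeasure_hausdorffMeasure (E := FF d)

lemma hausdorff_image_le {d : ℕ} {X Y Z : Type*} [MetricSpace X] [MetricSpace Y]
    [MetricSpace Z] [MeasurableSpace Y] [BorelSpace Y] [MeasurableSpace Z] [BorelSpace Z]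
    (f : X → Y) (g : X → Z) (K : Set X) (L : NNReal)
    (h : ∀ y ∈ K, ∀ z ∈ K, dist (f y) (f z) ≤ L * dist (g y) (g z)) :
    μH[(d : ℝ)] (f '' K) ≤ (L : ℝ≥0∞) ^ d * μH[(d : ℝ)] (g '' K) := by
  classical
  rcases isEmpty_or_nonempty X with hX | hX
  · simp [Set.eq_empty_of_isEmpty K]
  let i := Function.invFunOn g K
  have hi : ∀ y ∈ K, i (g y) ∈ K ∧ g (i (g y)) = g y := fun y hy =>
    ⟨Function.invFunOn_mem ⟨y, hy, rfl⟩, Function.invFunOn_eq ⟨y, hy, rfl⟩⟩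
  have hL : LipschitzOnWith L (f ∘ i) (g '' K) := by
    refine LipschitzOnWith.of_dist_le_mul ?_
    rintro _ ⟨y, hy, rfl⟩ _ ⟨z, hz, rfl⟩
    have := h _ (hi y hy).1 _ (hi z hz).1
    rwa [(hi y hy).2, (hi z hz).2] at this
  have heq : (f ∘ i) '' (g '' K) = f '' K := by
    rw [image_image]
    refine image_congr fun y hy => ?_
    have := h _ (hi y hy).1 _ hy
    rw [(hi y hy).2, dist_self, mul_zero] at this
    exact dist_le_zero.1 this
  rw [← heq]
  simpa using hL.hausdorffMeasure_image_le (d := (d : ℝ)) (by positivity)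

lemma hausdorff_Tv_image {d : ℕ} {v w : EE d} (hv : ‖v‖ = 1) (hw : ‖w‖ = 1) (A : Set (FF d)) :
    μH[(d : ℝ)] (Tv v w '' A) = ENNReal.ofReal |⟪v, w⟫| * μH[(d : ℝ)] A := by
  rw [Measure.addHaar_image_linearMap, det_Tv v w hv hw]

lemma key_bounds {d : ℕ} {v w : EE d} (hv : ‖v‖ = 1) (hw : ‖w‖ = 1) {K : Set (EE d)} {η s : ℝ}
  (hη : 0 < η) (hη1 : η ≤ 1) (hs : 0 < s) (hs1 : s ≤ 1 / 2) (ha : η ≤ |⟪v, w⟫|)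
  (hK : ∀ y ∈ K, ∀ z ∈ K, |⟪y - z, w⟫| ≤ (s * η / 2) * ‖y - z‖) : ∀ y ∈ K, ∀ z ∈ K,
    (1 - s) * ‖y - z‖ ≤ ‖Pv w y - Pv w z‖ ∧
    (1 - s) * ‖Pv v y - Pv v z‖ ≤ ‖Tv v w (Pv w y) - Tv v w (Pv w z)‖ ∧
    (1 - s) * ‖Tv v w (Pv w y) - Tv v w (Pv w z)‖ ≤ ‖Pv v y - Pv v z‖ := by
  intro y hy z hz
  have h0 := hK y hy z hz
  rw [← map_sub, ← map_sub, ← map_sub, ← map_sub]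
  set u := y - z
  have hu := norm_nonneg u
  have hsη : s * η ≤ s := by nlinarith
  have h1 : ‖u‖ ≤ ‖Pv w u‖ + s * η / 2 * ‖u‖ := by
    have : u = Jv w (Pv w u) + ⟪u, w⟫ • w := by rw [Jv_Pv w hw]; abel
    calc ‖u‖ = ‖Jv w (Pv w u) + ⟪u, w⟫ • w‖ := by rw [← this]
      _ ≤ ‖Jv w (Pv w u)‖ + ‖⟪u, w⟫ • w‖ := norm_add_le _ _
      _ ≤ _ := by
        rw [LinearIsometry.norm_map, norm_smul, hw, mul_one, Real.norm_eq_abs]; gcongr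
  have h2 : Pv v u = Tv v w (Pv w u) + ⟪u, w⟫ • Pv v w := by
    rw [Tv_apply, Jv_Pv w hw, (Pv v).map_sub u, map_smul]; abel
  have h3 : ‖⟪u, w⟫ • Pv v w‖ ≤ s * η / 2 * ‖u‖ := by
    rw [norm_smul, Real.norm_eq_abs]
    have := norm_Pv_le v hv w
    rw [hw] at this
    calc _ ≤ |⟪u, w⟫| * 1 := by gcongr
      _ ≤ _ := by linarith
  have h4 : (1 - s) * ‖u‖ ≤ ‖Pv w u‖ := by nlinarith
  have h5 : ‖u‖ ≤ 2 * ‖Pv w u‖ := by nlinarith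
  have h6 := Tv_lower v w hv hw (Pv w u)
  have h7 : s * η / 2 * ‖u‖ ≤ s * ‖Tv v w (Pv w u)‖ := by
    have : η * ‖Pv w u‖ ≤ ‖Tv v w (Pv w u)‖ := le_trans (by gcongr) h6
    calc s * η / 2 * ‖u‖ ≤ s * η / 2 * (2 * ‖Pv w u‖) := by gcongr
      _ = s * (η * ‖Pv w u‖) := by ring
      _ ≤ _ := by gcongr
  have h8 : ‖Pv v u‖ ≤ ‖Tv v w (Pv w u)‖ + s * ‖Tv v w (Pv w u)‖ := by
    rw [h2]; exact (norm_add_le _ _).trans (by linarith)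
  have h9 : ‖Tv v w (Pv w u)‖ ≤ ‖Pv v u‖ + s * ‖Tv v w (Pv w u)‖ := by
    have : Tv v w (Pv w u) = Pv v u - ⟪u, w⟫ • Pv v w := by rw [h2]; abel
    calc _ = ‖Pv v u - ⟪u, w⟫ • Pv v w‖ := by rw [← this]
      _ ≤ _ := (norm_sub_le _ _).trans (by linarith)
  refine ⟨h4, ?_, by linarith⟩
  have := norm_nonneg (Tv v w (Pv w u))
  nlinarith [mul_nonneg hs.le (mul_nonneg hs.le this)]

lemma key_inj {d : ℕ} {v w : EE d} (hv : ‖v‖ = 1) (hw : ‖w‖ = 1) {K : Set (EE d)} {η s : ℝ}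
  (hη : 0 < η) (hη1 : η ≤ 1) (hs : 0 < s) (hs1 : s ≤ 1 / 2) (ha : η ≤ |⟪v, w⟫|)
  (hK : ∀ y ∈ K, ∀ z ∈ K, |⟪y - z, w⟫| ≤ (s * η / 2) * ‖y - z‖) : InjOn (Pv v) K := by
  intro y hy z hz h
  obtain ⟨h1, h2, h3⟩ := key_bounds hv hw hη hη1 hs hs1 ha hK y hy z hz
  rw [h, sub_self, norm_zero, ← map_sub] at h3
  have h4 := Tv_lower v w hv hw (Pv w y - Pv w z)
  have h5 : ‖Tv v w (Pv w y - Pv w z)‖ ≤ 0 := by nlinarith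
  have h6 : ‖Pv w y - Pv w z‖ ≤ 0 := by nlinarith [norm_nonneg (Pv w y - Pv w z)]
  have h7 : ‖y - z‖ ≤ 0 := by nlinarith
  exact sub_eq_zero.1 (norm_le_zero_iff.1 h7)

lemma key_upper {d : ℕ} {v w : EE d} (hv : ‖v‖ = 1) (hw : ‖w‖ = 1) {K : Set (EE d)} {η s : ℝ}
  (hη : 0 < η) (hη1 : η ≤ 1) (hs : 0 < s) (hs1 : s ≤ 1 / 2) (ha : η ≤ |⟪v, w⟫|)
  (hK : ∀ y ∈ K, ∀ z ∈ K, |⟪y - z, w⟫| ≤ (s * η / 2) * ‖y - z‖) : μH[(d : ℝ)] (Pv v '' K) ≤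
    ENNReal.ofReal (1 / (1 - s)) ^ (2 * d) * (ENNReal.ofReal |⟪v, w⟫| * μH[(d : ℝ)] K) := by
  have hs2 : 0 < 1 - s := by linarith
  have hb := key_bounds hv hw hη hη1 hs hs1 ha hK
  have h1 := hausdorff_image_le (d := d) (Pv v) (fun x => Tv v w (Pv w x)) K
    (1 / (1 - s)).toNNReal (by
      intro y hy z hz
      rw [dist_eq_norm, dist_eq_norm, Real.coe_toNNReal _ (by positivity), one_div,
        inv_mul_eq_div, le_div_iff₀ hs2, mul_comm]
      exact (hb y hy z hz).2.1)
  have h2 := hausdorff_image_le (d := d) (Pv w) id K 1 (by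
    intro y hy z hz
    rw [dist_eq_norm, ← map_sub]
    simpa [dist_eq_norm] using norm_Pv_le w hw (y - z))
  rw [← image_image (Tv v w), hausdorff_Tv_image hv hw] at h1
  simp only [ENNReal.coe_one, one_pow, one_mul, image_id] at h2
  refine h1.trans ?_
  change ENNReal.ofReal (1 / (1 - s)) ^ d * _ ≤ _
  gcongr
  · rw [ENNReal.one_le_ofReal, one_div]; exact (one_le_inv₀ hs2).2 (by linarith)
  · omega

lemma key_lower {d : ℕ} {v w : EE d} (hv : ‖v‖ = 1) (hw : ‖w‖ = 1) {K : Set (EE d)} {η s : ℝ}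
  (hη : 0 < η) (hη1 : η ≤ 1) (hs : 0 < s) (hs1 : s ≤ 1 / 2) (ha : η ≤ |⟪v, w⟫|)
  (hK : ∀ y ∈ K, ∀ z ∈ K, |⟪y - z, w⟫| ≤ (s * η / 2) * ‖y - z‖) : ENNReal.ofReal |⟪v, w⟫| * μH[(d : ℝ)] K ≤
    ENNReal.ofReal (1 / (1 - s)) ^ (2 * d) * μH[(d : ℝ)] (Pv v '' K) := by
  have hs2 : 0 < 1 - s := by linarith
  have hb := key_bounds hv hw hη hη1 hs hs1 ha hK
  have h1 := hausdorff_image_le (d := d) (fun x => Tv v w (Pv w x)) (Pv v) K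
    (1 / (1 - s)).toNNReal (by
      intro y hy z hz
      rw [dist_eq_norm, dist_eq_norm, Real.coe_toNNReal _ (by positivity), one_div,
        inv_mul_eq_div, le_div_iff₀ hs2, mul_comm]
      exact (hb y hy z hz).2.2)
  have h2 := hausdorff_image_le (d := d) id (Pv w) K (1 / (1 - s)).toNNReal (by
    intro y hy z hz
    rw [dist_eq_norm, dist_eq_norm, Real.coe_toNNReal _ (by positivity), one_div,
        inv_mul_eq_div, le_div_iff₀ hs2, mul_comm]
    exact (hb y hy z hz).1)
  rw [← image_image (Tv v w), hausdorff_Tv_image hv hw] at h1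
  simp only [image_id] at h2
  change _ ≤ ENNReal.ofReal (1 / (1 - s)) ^ d * _ at h1
  change _ ≤ ENNReal.ofReal (1 / (1 - s)) ^ d * _ at h2
  calc _ ≤ ENNReal.ofReal |⟪v, w⟫| *
        (ENNReal.ofReal (1 / (1 - s)) ^ d * μH[(d : ℝ)] (Pv w '' K)) := by gcongr
    _ = ENNReal.ofReal (1 / (1 - s)) ^ d *
        (ENNReal.ofReal |⟪v, w⟫| * μH[(d : ℝ)] (Pv w '' K)) := by ring
    _ ≤ ENNReal.ofReal (1 / (1 - s)) ^ d * (ENNReal.ofReal (1 / (1 - s)) ^ d *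
        μH[(d : ℝ)] (Pv v '' K)) := by gcongr
    _ = _ := by rw [two_mul, pow_add, mul_assoc]


lemma flat_local {d : ℕ} {S : Set (EE d)} (hS : IsCompactSmoothHypersurface S) {x : EE d}
    (hx : x ∈ S) {ε : ℝ} (hε : 0 < ε) : ∃ w : EE d, ‖w‖ = 1 ∧ ∃ U : Set (EE d), IsOpen U ∧ x ∈ U ∧
      ∀ y ∈ S ∩ U, ∀ z ∈ S ∩ U, |⟪y - z, w⟫| ≤ ε * ‖y - z‖ := by
  obtain ⟨U, hU, hxU, f, hf, hf', hSU⟩ := hS.2 x hx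
  have hstrict : HasStrictFDerivAt f (fderiv ℝ f x) x :=
    hf.contDiffAt.hasStrictFDerivAt (by simp)
  set g : EE d := (InnerProductSpace.toDual ℝ (EE d)).symm (fderiv ℝ f x) with hg
  have hg0 : g ≠ 0 := by
    rw [hg]; simpa using hf' x hxU
  have hgn : 0 < ‖g‖ := norm_pos_iff.2 hg0
  have hgi : ∀ u, fderiv ℝ f x u = ⟪g, u⟫ := fun u => by
    rw [hg, InnerProductSpace.toDual_symm_apply]
  have hev := hstrict.isLittleO.bound (c := ε * ‖g‖) (by positivity)
  rw [nhds_prod_eq] at hev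
  obtain ⟨t, ht, h'⟩ := Filter.mem_prod_same_iff.1 hev
  have h := fun y (hy : y ∈ t) z (hz : z ∈ t) => h' (Set.mk_mem_prod hy hz)
  obtain ⟨V, hVt, hV, hxV⟩ := _root_.mem_nhds_iff.1 ht
  refine ⟨‖g‖⁻¹ • g, by rw [norm_smul]; simp [hgn.ne'], U ∩ V, hU.inter hV, ⟨hxU, hxV⟩, ?_⟩
  rintro y ⟨hyS, hyU, hyV⟩ z ⟨hzS, hzU, hzV⟩
  have h1 := h y (hVt hyV) z (hVt hzV)
  have hy0 : f y = 0 := (hSU.subset ⟨hyS, hyU⟩).2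
  have hz0 : f z = 0 := (hSU.subset ⟨hzS, hzU⟩).2
  simp only [mem_ofPred_eq, hy0, hz0, hgi] at h1
  rw [sub_zero, zero_sub, norm_neg, Real.norm_eq_abs] at h1
  rw [inner_smul_right, abs_mul, abs_inv, abs_norm, real_inner_comm, inv_mul_le_iff₀ hgn]
  linarith

lemma hausdorff_lt_top {d : ℕ} {S : Set (EE d)} (hS : IsCompactSmoothHypersurface S) :
    μH[(d : ℝ)] S < ∞ := by
  refine hS.1.measure_lt_top_of_nhdsWithin fun x hx => ?_
  obtain ⟨w, hw, U, hU, hxU, h⟩ := flat_local hS hx (ε := (1 / 2) * 1 / 2) (by norm_num)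
  refine ⟨S ∩ (U ∩ ball x 1), ?_, ?_⟩
  · exact Filter.inter_mem self_mem_nhdsWithin (mem_nhdsWithin_of_mem_nhds
      (Filter.inter_mem (hU.mem_nhds hxU) (ball_mem_nhds x one_pos)))
  · have := key_lower (K := S ∩ (U ∩ ball x 1)) hw hw one_pos le_rfl (s := 1 / 2) (by norm_num)
      le_rfl (by rw [real_inner_self_eq_norm_sq, hw]; simp)
      (fun y hy z hz => h y ⟨hy.1, hy.2.1⟩ z ⟨hz.1, hz.2.1⟩)
    rw [real_inner_self_eq_norm_sq, hw] at this
    simp only [one_pow, abs_one, ENNReal.ofReal_one, one_mul] at this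
    refine this.trans_lt (ENNReal.mul_lt_top (ENNReal.pow_lt_top ENNReal.ofReal_lt_top) ?_)
    have hb : Bornology.IsBounded (Pv w '' (S ∩ (U ∩ ball x 1))) :=
      (Pv w).lipschitz.isBounded_image
        (isBounded_ball.subset (inter_subset_right.trans inter_subset_right))
    exact hb.measure_lt_top

lemma sphere_hypersurface (d : ℕ) : IsCompactSmoothHypersurface (sphere (0 : EE d) 1) := by
  refine ⟨isCompact_sphere _ _, fun x hx => ⟨{0}ᶜ, isOpen_compl_singleton, ?_,
    fun y => ‖y‖ ^ 2 - 1, ?_, ?_, ?_⟩⟩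
  · rintro rfl; simp at hx
  · exact (contDiff_norm_sq ℝ).sub contDiff_const
  · intro y hy h
    have h1 : HasFDerivAt (fun y : EE d => ‖y‖ ^ 2 - 1) (2 • (innerSL ℝ y)) y :=
      (hasStrictFDerivAt_norm_sq y).hasFDerivAt.sub_const 1
    rw [h1.fderiv] at h
    have := congrArg (fun L => L y) h
    simp at this
    exact hy this
  · ext y
    simp only [mem_inter_iff, mem_sphere, dist_zero_right, mem_ofPred_eq]
    constructor
    · rintro ⟨h1, h2⟩; exact ⟨h2, by rw [h1]; norm_num⟩
    · rintro ⟨h1, h2⟩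
      exact ⟨by nlinarith [norm_nonneg y, sq_nonneg (‖y‖ - 1)], h1⟩

lemma sphere_lt_top (d : ℕ) : μH[(d : ℝ)] (sphere (0 : EE d) 1) < ∞ :=
  hausdorff_lt_top (sphere_hypersurface d)

lemma sphere_pos (d : ℕ) : 0 < μH[(d : ℝ)] (sphere (0 : EE d) 1) := by
  set w := baseVec d
  have hw : ‖w‖ = 1 := norm_baseVec d
  have h2 := hausdorff_image_le (d := d) (Pv w) id (sphere (0 : EE d) 1) 1 (by
    intro y hy z hz
    rw [dist_eq_norm, ← map_sub]
    simpa [dist_eq_norm] using norm_Pv_le w hw (y - z))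
  simp only [ENNReal.coe_one, one_pow, one_mul, image_id] at h2
  refine lt_of_lt_of_le ?_ h2
  refine lt_of_lt_of_le (measure_ball_pos μH[(d : ℝ)] (0 : FF d) one_pos) (measure_mono ?_)
  intro p hp
  have hp1 : ‖p‖ < 1 := by simpa using hp
  refine ⟨Jv w p + Real.sqrt (1 - ‖p‖ ^ 2) • w, ?_, ?_⟩
  · have h0 : 0 ≤ 1 - ‖p‖ ^ 2 := by nlinarith [norm_nonneg p]
    have : ‖Jv w p + Real.sqrt (1 - ‖p‖ ^ 2) • w‖ ^ 2 = 1 := by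
      rw [norm_add_sq_real, inner_smul_right, Jv_inner w hw, norm_smul, hw, mul_one,
        LinearIsometry.norm_map, Real.norm_eq_abs, sq_abs, Real.sq_sqrt h0]
      ring
    rw [mem_sphere_zero_iff_norm]
    have h3 := norm_nonneg (Jv w p + Real.sqrt (1 - ‖p‖ ^ 2) • w)
    nlinarith
  · rw [map_add, Pv_Jv, map_smul, Pv_self w hw]; simp

lemma sphere_null {d : ℕ} (w : EE d) (hw : ‖w‖ = 1) :
    μH[(d : ℝ)] {v : EE d | ‖v‖ = 1 ∧ ⟪v, w⟫ = 0} = 0 := by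
  have : {v : EE d | ‖v‖ = 1 ∧ ⟪v, w⟫ = 0} ⊆ Jv w '' (sphere 0 1) := by
    rintro v ⟨hv, h⟩
    obtain ⟨p, rfl⟩ := Jv_surj w hw v h
    exact ⟨p, by simpa using hv, rfl⟩
  refine measure_mono_null this ?_
  rw [(Jv w).isometry.hausdorffMeasure_image (Or.inl (by positivity))]
  exact Measure.addHaar_sphere_of_ne_zero _ _ one_ne_zero

/-- A countable measurable partition with mesh at most `2 / (k + 1)`. -/
def cell {d : ℕ} (k i : ℕ) : Set (EE d) :=
  disjointed (fun i => ball (TopologicalSpace.denseSeq (EE d) i) (1 / ((k : ℝ) + 1))) i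

lemma cell_iUnion {d : ℕ} (k : ℕ) : ⋃ i, cell (d := d) k i = univ := by
  simp only [cell, iUnion_disjointed]
  refine eq_univ_of_forall fun x => ?_
  obtain ⟨y, ⟨i, rfl⟩, hy⟩ := Metric.dense_iff.1 (TopologicalSpace.denseRange_denseSeq (EE d)) x
    (1 / ((k : ℝ) + 1)) (by positivity) |>.imp fun y hy => And.intro hy.2 hy.1
  exact mem_iUnion.2 ⟨i, by rw [mem_ball_comm]; exact hy⟩

lemma cell_disjoint {d : ℕ} (k : ℕ) : Pairwise (Function.onFun Disjoint (cell (d := d) k)) :=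
  disjoint_disjointed _

lemma cell_measurable {d : ℕ} (k i : ℕ) : MeasurableSet (cell (d := d) k i) :=
  MeasurableSet.disjointed (fun _ => measurableSet_ball) i

lemma cell_dist {d : ℕ} (k i : ℕ) {x y : EE d} (hx : x ∈ cell k i) (hy : y ∈ cell k i) :
    dist x y < 2 / ((k : ℝ) + 1) := by
  have hx' := disjointed_subset _ _ hx
  have hy' := disjointed_subset _ _ hy
  rw [mem_ball] at hx' hy'
  calc dist x y ≤ _ := dist_triangle_right x y _
    _ < _ := add_lt_add hx' hy'
    _ = _ := by ring

lemma cell_sigma {d : ℕ} (k i : ℕ) {K : Set (EE d)} (hK : IsCompact K) :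
    ∃ C : ℕ → Set (EE d), (∀ j, IsCompact (C j)) ∧ K ∩ cell k i = ⋃ j, C j := by
  obtain ⟨G, hG, -, hGU, -⟩ := IsOpen.exists_iUnion_isClosed
    (isOpen_ball (x := TopologicalSpace.denseSeq (EE d) i) (ε := 1 / ((k : ℝ) + 1)))
  set D : Set (EE d) := ⋂ j < i, (ball (TopologicalSpace.denseSeq (EE d) j) (1 / ((k : ℝ) + 1)))ᶜ
  have hD : IsClosed D := isClosed_biInter fun j _ => isOpen_ball.isClosed_compl
  refine ⟨fun j => K ∩ (G j ∩ D), fun j => hK.inter_right ((hG j).inter hD), ?_⟩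
  rw [cell, disjointed_eq_inter_compl, ← hGU, iUnion_inter, inter_iUnion]

open scoped Classical in
/-- Number of cells of the `k`-th partition meeting `A`. -/
def gk {d : ℕ} (k : ℕ) (A : Set (EE d)) : ℝ≥0∞ :=
  ∑' i, if (A ∩ cell k i).Nonempty then 1 else 0

lemma gk_le_count {d : ℕ} (k : ℕ) {A : Set (EE d)} (hA : MeasurableSet A) :
    gk k A ≤ Measure.count A := by
  have h : Measure.count A = ∑' i, Measure.count (A ∩ cell k i) := by
    rw [← measure_iUnion, ← inter_iUnion, cell_iUnion, inter_univ]
    · exact fun i j hij => ((cell_disjoint k hij).mono inter_subset_right inter_subset_right)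
    · exact fun i => hA.inter (cell_measurable k i)
  rw [h]
  refine ENNReal.tsum_le_tsum fun i => ?_
  split_ifs with hne
  · obtain ⟨x, hx⟩ := hne
    calc (1 : ℝ≥0∞) = Measure.count ({x} : Set (EE d)) := by simp
      _ ≤ _ := measure_mono (by simpa using hx)
  · exact zero_le

lemma count_le_of_finset {d : ℕ} {A : Set (EE d)} {c : ℝ≥0∞}
    (h : ∀ t : Finset (EE d), (t : Set (EE d)) ⊆ A → (t.card : ℝ≥0∞) ≤ c) :
    Measure.count A ≤ c := by
  by_cases hA : A.Finite
  · rw [Measure.count_apply_finite A hA]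
    exact h _ (by simp)
  · rw [Measure.count_apply_infinite hA]
    refine le_of_eq (ENNReal.eq_top_of_forall_nnreal_le fun r => ?_).symm
    obtain ⟨m, hm⟩ := exists_nat_ge r
    obtain ⟨t, ht, hc⟩ := Set.Infinite.exists_subset_card_eq hA m
    have := h t ht
    rw [hc] at this
    exact le_trans (by exact_mod_cast hm) this

lemma count_le_liminf {d : ℕ} (A : Set (EE d)) :
    Measure.count A ≤ liminf (fun k => gk k A) atTop := by
  classical
  refine count_le_of_finset fun t ht => ?_
  refine le_liminf_of_le (by isBoundedDefault) ?_
  obtain ⟨δ, hδ, hsep⟩ : ∃ δ > 0, ∀ x ∈ t, ∀ y ∈ t, x ≠ y → δ ≤ dist x y := by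
    rcases t.offDiag.eq_empty_or_nonempty with he | hne
    · refine ⟨1, one_pos, fun x hx y hy hxy => ?_⟩
      have : (x, y) ∈ t.offDiag := by simp [hx, hy, hxy]
      rw [he] at this; simp at this
    · obtain ⟨z, hz, hmin⟩ := t.offDiag.exists_min_image (fun z => dist z.1 z.2) hne
      refine ⟨dist z.1 z.2, dist_pos.2 (Finset.mem_offDiag.1 hz).2.2, fun x hx y hy hxy => ?_⟩
      exact hmin (x, y) (by simp [hx, hy, hxy])
  have hlim : Tendsto (fun k : ℕ => 2 / ((k : ℝ) + 1)) atTop (𝓝 0) := by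
    have := (tendsto_one_div_add_atTop_nhds_zero_nat (𝕜 := ℝ)).const_mul 2
    simpa [div_eq_mul_inv] using this
  filter_upwards [hlim.eventually (gt_mem_nhds hδ)] with k hk
  have hex : ∀ x : EE d, ∃ i, x ∈ cell k i := fun x => by
    have : x ∈ ⋃ i, cell (d := d) k i := by rw [cell_iUnion]; trivial
    exact mem_iUnion.1 this
  choose idx hidx using hex
  have hinj : Set.InjOn idx t := by
    intro x hx y hy hxy
    by_contra hne
    have h1 := hsep x hx y hy hne
    have h2 := cell_dist k (idx x) (hidx x) (hxy ▸ hidx y)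
    linarith
  calc (t.card : ℝ≥0∞) = ∑ i ∈ t.image idx, (1 : ℝ≥0∞) := by
        rw [Finset.sum_const, Finset.card_image_of_injOn hinj]; simp
    _ = ∑ i ∈ t.image idx, (if (A ∩ cell k i).Nonempty then (1 : ℝ≥0∞) else 0) := by
        refine Finset.sum_congr rfl fun i hi => ?_
        obtain ⟨x, hx, rfl⟩ := Finset.mem_image.1 hi
        rw [if_pos ⟨x, ht hx, hidx x⟩]
    _ ≤ gk k A := ENNReal.sum_le_tsum _

lemma count_eq_liminf {d : ℕ} {A : Set (EE d)} (hA : MeasurableSet A) :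
    Measure.count A = liminf (fun k => gk k A) atTop := by
  refine le_antisymm (count_le_liminf A) ?_
  refine (liminf_le_of_frequently_le' (Frequently.of_forall fun k => gk_le_count k hA))

/-- Points on the line `q` (empty unless `q` is a genuine line). -/
def hits {d : ℕ} (q : EE d × EE d) : Set (EE d) :=
  {x | ‖q.1‖ = 1 ∧ q.2 = x - ⟪x, q.1⟫ • q.1}

lemma hits_closed {d : ℕ} (q : EE d × EE d) : IsClosed (hits q) := by
  refine IsClosed.inter (s₁ := {x | ‖q.1‖ = 1}) (s₂ := {x | q.2 = x - ⟪x, q.1⟫ • q.1})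
    isClosed_const (isClosed_eq continuous_const (by fun_prop))

lemma hits_compact {d : ℕ} {K : Set (EE d)} (hK : IsCompact K) :
    MeasurableSet {q : EE d × EE d | (hits q ∩ K).Nonempty} := by
  have : {q : EE d × EE d | (hits q ∩ K).Nonempty} =
      (fun z : EE d × EE d => (z.1, z.2 - ⟪z.2, z.1⟫ • z.1)) '' (sphere 0 1 ×ˢ K) := by
    ext q
    constructor
    · rintro ⟨x, ⟨h1, h2⟩, hx⟩
      exact ⟨(q.1, x), ⟨by simpa using h1, hx⟩, by ext1 <;> simp [h2]⟩
    · rintro ⟨⟨v, x⟩, ⟨h1, hx⟩, rfl⟩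
      exact ⟨x, ⟨by simpa using h1, rfl⟩, hx⟩
  rw [this]
  exact (((isCompact_sphere _ _).prod hK).image (by fun_prop)).measurableSet

lemma hits_cell {d : ℕ} {K : Set (EE d)} (hK : IsCompact K) (k i : ℕ) :
    MeasurableSet {q : EE d × EE d | (hits q ∩ K ∩ cell k i).Nonempty} := by
  obtain ⟨C, hC, hKC⟩ := cell_sigma k i hK
  have : {q : EE d × EE d | (hits q ∩ K ∩ cell k i).Nonempty} =
      ⋃ j, {q | (hits q ∩ C j).Nonempty} := by
    ext q
    simp only [mem_ofPred_eq, mem_iUnion, inter_assoc, hKC, inter_iUnion, nonempty_iUnion]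
  rw [this]
  exact MeasurableSet.iUnion fun j => hits_compact (hC j)

lemma measurable_gk {d : ℕ} {K : Set (EE d)} (hK : IsCompact K) (k : ℕ) :
    Measurable fun q : EE d × EE d => gk k (hits q ∩ K) := by
  classical
  unfold gk
  refine Measurable.tsum fun i => ?_
  exact Measurable.ite (hits_cell hK k i) measurable_const measurable_const

lemma measurable_count {d : ℕ} {K : Set (EE d)} (hK : IsCompact K) :
    Measurable fun q : EE d × EE d => Measure.count (hits q ∩ K) := by
  have : (fun q : EE d × EE d => Measure.count (hits q ∩ K)) =
      fun q => liminf (fun k => gk k (hits q ∩ K)) atTop := by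
    ext q
    exact count_eq_liminf ((hits_closed q).inter hK.isClosed).measurableSet
  rw [this]
  exact Measurable.liminf fun k => measurable_gk hK k

open scoped Classical in
/-- Counting measure on the intersection of `S` with the line, when finite. -/
def kap {d : ℕ} (S : Set (EE d)) (q : EE d × EE d) : Measure (EE d) :=
  if (hits q ∩ S).Finite then Measure.count.restrict (hits q ∩ S) else 0

instance kap_finite {d : ℕ} (S : Set (EE d)) (q : EE d × EE d) : IsFiniteMeasure (kap S q) := by
  unfold kap
  split_ifs with h
  · exact ⟨by rw [Measure.restrict_apply_univ]; exact Measure.count_apply_lt_top.2 h⟩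
  · infer_instance

lemma measurable_kap {d : ℕ} {S : Set (EE d)} (hS : IsCompact S) : Measurable (kap S) := by
  classical
  have hfin : MeasurableSet {q : EE d × EE d | (hits q ∩ S).Finite} := by
    have : {q : EE d × EE d | (hits q ∩ S).Finite} =
      {q | Measure.count (hits q ∩ S) < ∞} := by
      ext q
      exact Measure.count_apply_lt_top.symm
    rw [this]
    exact measurableSet_lt (measurable_count hS) measurable_const
  have hc : ∀ s : Set (EE d), IsClosed s → Measurable fun q => kap S q s := by
    intro s hs
    have : (fun q => kap S q s) = fun q => if (hits q ∩ S).Finite then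
        Measure.count (hits q ∩ (S ∩ s)) else 0 := by
      ext q
      unfold kap
      split_ifs
      · rw [Measure.restrict_apply hs.measurableSet, inter_comm, inter_assoc]
      · rfl
    rw [this]
    exact Measurable.ite hfin (measurable_count (hS.inter_right hs)) measurable_const
  refine Measurable.measure_of_isPiSystem
    (S := {s | IsClosed s}) ?_ isPiSystem_isClosed hc (hc _ isClosed_univ)
  rw [BorelSpace.measurable_eq (α := EE d), borel_eq_generateFrom_isClosed]

lemma hits_J {d : ℕ} (v : EE d) (hv : ‖v‖ = 1) (p : FF d) :
    hits (v, Jv v p) = {x | Pv v x = p} := by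
  ext x
  simp only [hits, mem_ofPred_eq, hv, true_and, ← Jv_Pv v hv x]
  exact ⟨fun h => ((Jv v).injective h).symm, fun h => by rw [h]⟩

lemma hits_line {d : ℕ} (q : EE d × EE d) (h1 : ‖q.1‖ = 1) (h2 : ⟪q.2, q.1⟫ = 0) :
    lineThrough q.1 q.2 = hits q := by
  ext x
  simp only [hits, lineThrough, mem_ofPred_eq, h1, true_and]
  constructor
  · rintro ⟨t, rfl⟩
    rw [inner_add_left, inner_smul_left, h2, real_inner_self_eq_norm_sq, h1]
    simp
  · intro h
    exact ⟨⟪x, q.1⟫, by rw [h]; abel⟩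

/-- Surface measure on the unit sphere. -/
def sig (d : ℕ) : Measure (EE d) := (μH[(d : ℝ)]).restrict (sphere (0 : EE d) 1)

instance sig_finite (d : ℕ) : IsFiniteMeasure (sig d) :=
  ⟨by rw [sig, Measure.restrict_apply_univ]; exact sphere_lt_top d⟩

lemma sig_ae (d : ℕ) : ∀ᵐ v ∂(sig d), ‖v‖ = 1 := by
  have := ae_restrict_mem (μ := μH[(d : ℝ)]) (s := sphere (0 : EE d) 1) isClosed_sphere.measurableSet
  filter_upwards [this] with v hv
  simpa using hv

/-- Parametrization of lines. -/
def Psi {d : ℕ} (z : EE d × FF d) : EE d × EE d := (z.1, Jv z.1 z.2)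

lemma measurable_Psi (d : ℕ) : Measurable (Psi (d := d)) :=
  measurable_fst.prodMk (measurable_Jv d)

lemma restrict_perp {d : ℕ} (v : EE d) (hv : ‖v‖ = 1) :
    (μH[(d : ℝ)]).restrict {p : EE d | ⟪p, v⟫ = 0} = Measure.map (Jv v) μH[(d : ℝ)] := by
  rw [Isometry.map_hausdorffMeasure (Jv v).isometry (Or.inl (by positivity))]
  congr 1
  ext x
  constructor
  · intro hx
    obtain ⟨p, hp⟩ := Jv_surj v hv x hx
    exact ⟨p, hp⟩
  · rintro ⟨p, rfl⟩
    exact Jv_inner v hv p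

instance sfiniteFF (d : ℕ) : SFinite (μH[(d : ℝ)] : Measure (FF d)) := inferInstance

lemma kin_eq (d : ℕ) :
    Measure.bind (sig d) (fun v => Measure.map (fun p => (v, p))
      ((μH[(d : ℝ)]).restrict {p : EE d | ⟪p, v⟫ = 0})) =
    Measure.map Psi ((sig d).prod (μH[(d : ℝ)] : Measure (FF d))) := by
  have hm : Measurable fun v : EE d => Measure.map Psi
      (Measure.map (Prod.mk v) (μH[(d : ℝ)] : Measure (FF d))) :=
    (Measure.measurable_map _ (measurable_Psi d)).comp Measurable.map_prodMk_left
  have h1 : (fun v => Measure.map (fun p => (v, p))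
      ((μH[(d : ℝ)]).restrict {p : EE d | ⟪p, v⟫ = 0})) =ᵐ[sig d]
      fun v : EE d => Measure.map Psi
      (Measure.map (Prod.mk v) (μH[(d : ℝ)] : Measure (FF d))) := by
    filter_upwards [sig_ae d] with v hv
    rw [restrict_perp v hv, Measure.map_map (by fun_prop) (Jv v).continuous.measurable,
      Measure.map_map (measurable_Psi d) (by fun_prop)]
    rfl
  rw [Measure.bind_congr_right h1]
  ext s hs
  rw [Measure.bind_apply hs hm.aemeasurable, Measure.map_apply (measurable_Psi d) hs,
    Measure.prod_apply (measurable_Psi d hs)]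
  refine lintegral_congr fun v => ?_
  rw [Measure.map_apply (measurable_Psi d) hs, Measure.map_apply (by fun_prop) (measurable_Psi d hs)]

/-- The kinematic measure, parametrized. -/
def kin (d : ℕ) : Measure (EE d × EE d) :=
  Measure.map Psi ((sig d).prod (μH[(d : ℝ)] : Measure (FF d)))

lemma kinematic_eq (d : ℕ) : kinematicMeasure (d + 1) = kin d := by
  have h : (((d + 1 : ℕ) : ℝ) - 1) = (d : ℝ) := by push_cast; ring
  unfold kinematicMeasure
  rw [h]
  exact kin_eq d

lemma lintegral_kin {d : ℕ} {g : EE d × EE d → ℝ≥0∞} (hg : Measurable g) :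
    ∫⁻ q, g q ∂(kin d) = ∫⁻ v, ∫⁻ p : FF d, g (v, Jv v p) ∂μH[(d : ℝ)] ∂(sig d) := by
  rw [kin, lintegral_map hg (measurable_Psi d),
    lintegral_prod (fun z : EE d × FF d => g (Psi z)) (hg.comp (measurable_Psi d)).aemeasurable]
  rfl

lemma kin_ae (d : ℕ) : ∀ᵐ q ∂(kin d), ‖q.1‖ = 1 ∧ ⟪q.2, q.1⟫ = 0 := by
  have hms : MeasurableSet {q : EE d × EE d | ‖q.1‖ = 1 ∧ ⟪q.2, q.1⟫ = 0} := by
    refine (IsClosed.inter (s₁ := {q : EE d × EE d | ‖q.1‖ = 1})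
      (s₂ := {q : EE d × EE d | ⟪q.2, q.1⟫ = 0}) ?_ ?_).measurableSet
    · exact isClosed_eq (by fun_prop) (by fun_prop)
    · exact isClosed_eq (by fun_prop) (by fun_prop)
  rw [kin, ae_map_iff (measurable_Psi d).aemeasurable hms]
  have : ∀ᵐ z ∂((sig d).prod (μH[(d : ℝ)] : Measure (FF d))), ‖z.1‖ = 1 :=
    Measure.quasiMeasurePreserving_fst.ae (sig_ae d)
  filter_upwards [this] with z hz
  exact ⟨hz, Jv_inner _ hz _⟩

lemma kin_ball (d : ℕ) (r : ℝ) : kin d {q | ‖q.2‖ < r} =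
    μH[(d : ℝ)] (ball (0 : FF d) r) * μH[(d : ℝ)] (sphere (0 : EE d) 1) := by
  have hms : MeasurableSet {q : EE d × EE d | ‖q.2‖ < r} :=
    (isOpen_lt (by fun_prop) (by fun_prop)).measurableSet
  rw [kin, Measure.map_apply (measurable_Psi d) hms]
  have : Psi ⁻¹' {q : EE d × EE d | ‖q.2‖ < r} = univ ×ˢ (ball (0 : FF d) r) := by
    ext z
    simp [Psi]
  rw [this, Measure.prod_prod, sig, Measure.restrict_apply_univ, mul_comm]

/-- For a fixed direction, the multiplicity integral is at most the area. -/
lemma lintegral_count_le {d : ℕ} {v : EE d} (hv : ‖v‖ = 1) {K : Set (EE d)} (hK : IsCompact K) :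
    ∫⁻ p : FF d, Measure.count (hits (v, Jv v p) ∩ K) ∂μH[(d : ℝ)] ≤ μH[(d : ℝ)] K := by
  classical
  have hgm : ∀ k, Measurable fun p : FF d => gk k (hits (v, Jv v p) ∩ K) := fun k =>
    (measurable_gk hK k).comp (g := fun q : EE d × EE d => gk k (hits q ∩ K))
      (f := fun p : FF d => (v, Jv v p)) (by
        have := (Jv v).continuous; fun_prop)
  have hle : ∀ k, ∫⁻ p : FF d, gk k (hits (v, Jv v p) ∩ K) ∂μH[(d : ℝ)] ≤ μH[(d : ℝ)] K := by
    intro k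
    have hset : ∀ i, {p : FF d | (hits (v, Jv v p) ∩ K ∩ cell k i).Nonempty} =
        Pv v '' (K ∩ cell k i) := by
      intro i
      ext p
      rw [mem_ofPred_eq, hits_J v hv]
      constructor
      · rintro ⟨x, ⟨hx, hxK⟩, hxc⟩
        exact ⟨x, ⟨hxK, hxc⟩, hx⟩
      · rintro ⟨x, ⟨hxK, hxc⟩, hx⟩
        exact ⟨x, ⟨hx, hxK⟩, hxc⟩
    have hms : ∀ i, MeasurableSet {p : FF d | (hits (v, Jv v p) ∩ K ∩ cell k i).Nonempty} := by
      intro i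
      have hJ : Measurable fun p : FF d => ((v, Jv v p) : EE d × EE d) := by
        have := (Jv v).continuous; fun_prop
      exact hJ (hits_cell hK k i)
    unfold gk
    rw [lintegral_tsum fun i => (Measurable.ite (hms i) measurable_const
      measurable_const).aemeasurable]
    calc _ = ∑' i, μH[(d : ℝ)] (Pv v '' (K ∩ cell k i)) := by
          congr 1; ext i
          rw [← hset i, ← lintegral_indicator_one (hms i)]
          refine lintegral_congr fun p => ?_
          simp [indicator]
      _ ≤ ∑' i, μH[(d : ℝ)] (K ∩ cell k i) := by
          refine ENNReal.tsum_le_tsum fun i => ?_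
          have hl : LipschitzOnWith 1 (Pv v) (K ∩ cell k i) := by
            refine LipschitzOnWith.of_dist_le_mul fun x _ y _ => ?_
            rw [dist_eq_norm, dist_eq_norm, ← map_sub]
            simpa using norm_Pv_le v hv (x - y)
          simpa using hl.hausdorffMeasure_image_le (d := d) (by positivity)
      _ = μH[(d : ℝ)] K := by
          rw [← measure_iUnion, ← inter_iUnion, cell_iUnion, inter_univ]
          · exact fun i j hij => ((cell_disjoint k hij).mono inter_subset_right inter_subset_right)
          · exact fun i => hK.measurableSet.inter (cell_measurable k i)
  calc _ = ∫⁻ p : FF d, liminf (fun k => gk k (hits (v, Jv v p) ∩ K)) atTop ∂μH[(d : ℝ)] := by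
        refine lintegral_congr fun p => ?_
        exact count_eq_liminf ((hits_closed _).inter hK.isClosed).measurableSet
    _ ≤ liminf (fun k => ∫⁻ p : FF d, gk k (hits (v, Jv v p) ∩ K) ∂μH[(d : ℝ)]) atTop :=
        lintegral_liminf_le hgm
    _ ≤ _ := liminf_le_of_frequently_le' (Frequently.of_forall hle)

lemma ae_finite {d : ℕ} {S : Set (EE d)} (hS : IsCompactSmoothHypersurface S)
    {v : EE d} (hv : ‖v‖ = 1) :
    ∀ᵐ p : FF d ∂μH[(d : ℝ)], (hits (v, Jv v p) ∩ S).Finite := by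
  have hm : Measurable fun p : FF d => Measure.count (hits (v, Jv v p) ∩ S) :=
    (measurable_count hS.1).comp (g := fun q : EE d × EE d => Measure.count (hits q ∩ S))
      (f := fun p : FF d => (v, Jv v p)) (by
        have := (Jv v).continuous; fun_prop)
  have := ae_lt_top hm ((lintegral_count_le hv hS.1).trans_lt (hausdorff_lt_top hS)).ne
  filter_upwards [this] with p hp
  exact Measure.count_apply_lt_top.1 hp

lemma lintegral_kap_eq {d : ℕ} {S : Set (EE d)} (hS : IsCompactSmoothHypersurface S)
    {v : EE d} (hv : ‖v‖ = 1) {K : Set (EE d)} (hK : IsClosed K) :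
    ∫⁻ p : FF d, kap S (v, Jv v p) K ∂μH[(d : ℝ)] =
    ∫⁻ p : FF d, Measure.count (hits (v, Jv v p) ∩ (S ∩ K)) ∂μH[(d : ℝ)] := by
  refine lintegral_congr_ae ?_
  filter_upwards [ae_finite hS hv] with p hp
  rw [kap, if_pos hp, Measure.restrict_apply hK.measurableSet, inter_comm, inter_assoc]

lemma lintegral_kap_le {d : ℕ} {S : Set (EE d)} (hS : IsCompactSmoothHypersurface S)
    {v : EE d} (hv : ‖v‖ = 1) {K : Set (EE d)} (hK : IsClosed K) :
    ∫⁻ p : FF d, kap S (v, Jv v p) K ∂μH[(d : ℝ)] ≤ μH[(d : ℝ)] (S ∩ K) := by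
  rw [lintegral_kap_eq hS hv hK]
  exact lintegral_count_le hv (hS.1.inter_right hK)

lemma lintegral_kap_inj {d : ℕ} {S : Set (EE d)} (hS : IsCompactSmoothHypersurface S)
    {v : EE d} (hv : ‖v‖ = 1) {K : Set (EE d)} (hK : IsClosed K) (hi : InjOn (Pv v) (S ∩ K)) :
    ∫⁻ p : FF d, kap S (v, Jv v p) K ∂μH[(d : ℝ)] = μH[(d : ℝ)] (Pv v '' (S ∩ K)) := by
  classical
  rw [lintegral_kap_eq hS hv hK]
  have hms : MeasurableSet (Pv v '' (S ∩ K)) :=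
    ((hS.1.inter_right hK).image (Pv v).continuous).measurableSet
  rw [← lintegral_indicator_one hms]
  refine lintegral_congr fun p => ?_
  rw [hits_J v hv]
  by_cases hp : p ∈ Pv v '' (S ∩ K)
  · obtain ⟨x, hx, rfl⟩ := hp
    have : {y | Pv v y = Pv v x} ∩ (S ∩ K) = {x} := by
      ext y
      constructor
      · rintro ⟨h1, h2⟩
        exact hi h2 hx h1
      · rintro rfl
        exact ⟨rfl, hx⟩
    rw [this, indicator_of_mem (mem_image_of_mem _ hx)]
    simp
  · have : {y | Pv v y = p} ∩ (S ∩ K) = ∅ := by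
      ext y
      simp only [mem_inter_iff, mem_empty_iff_false, iff_false]
      rintro ⟨h1, h2⟩
      exact hp ⟨y, h2, h1⟩
    rw [this, indicator_of_notMem hp]
    simp

/-- The intersection measure. -/
def mS {d : ℕ} (S : Set (EE d)) : Measure (EE d) := (kin d).bind (kap S)

/-- The Crofton constant. -/
def CC (d : ℕ) : ℝ≥0∞ := ∫⁻ v, ENNReal.ofReal |⟪v, baseVec d⟫| ∂(sig d)

/-- Measure of an equatorial band. -/
def NN (d : ℕ) (η : ℝ) : ℝ≥0∞ := sig d {v | |⟪v, baseVec d⟫| < η}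

lemma sig_inv {d : ℕ} {w : EE d} (hw : ‖w‖ = 1) (g : ℝ → ℝ≥0∞) (hg : Measurable g) :
    ∫⁻ v, g ⟪v, w⟫ ∂(sig d) = ∫⁻ v, g ⟪v, baseVec d⟫ ∂(sig d) := by
  have h1 : MeasurePreserving (reflV w) (μH[(d : ℝ)] : Measure (EE d)) μH[(d : ℝ)] :=
    (reflV w).toIsometryEquiv.measurePreserving_hausdorffMeasure d
  have h2 := h1.restrict_preimage (s := sphere (0 : EE d) 1) isClosed_sphere.measurableSet
  have h3 : reflV w ⁻¹' sphere (0 : EE d) 1 = sphere 0 1 := by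
    ext x; simp
  rw [h3] at h2
  have h4 : Measurable fun v : EE d => g ⟪v, baseVec d⟫ := hg.comp (by fun_prop)
  have := h2.lintegral_comp h4
  unfold sig
  rw [← this]
  refine lintegral_congr fun v => ?_
  congr 1
  rw [← reflV_self w hw, LinearIsometryEquiv.inner_map_map]

lemma CC_eq {d : ℕ} {w : EE d} (hw : ‖w‖ = 1) :
    ∫⁻ v, ENNReal.ofReal |⟪v, w⟫| ∂(sig d) = CC d :=
  sig_inv hw (fun t => ENNReal.ofReal |t|) (by fun_prop)

lemma NN_eq {d : ℕ} {w : EE d} (hw : ‖w‖ = 1) (η : ℝ) :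
    sig d {v | |⟪v, w⟫| < η} = NN d η := by
  have hm : ∀ u : EE d, MeasurableSet {v : EE d | |⟪v, u⟫| < η} := fun u =>
    (isOpen_lt (by fun_prop) (by fun_prop)).measurableSet
  have ht : MeasurableSet {t : ℝ | |t| < η} := (isOpen_lt (by fun_prop) (by fun_prop)).measurableSet
  have := sig_inv hw ({t : ℝ | |t| < η}.indicator 1) (measurable_one.indicator ht)
  rw [NN, ← lintegral_indicator_one (hm w), ← lintegral_indicator_one (hm _)]
  exact this

lemma CC_lt_top (d : ℕ) : CC d < ∞ := by
  calc CC d ≤ ∫⁻ v, 1 ∂(sig d) := by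
        refine lintegral_mono_ae ?_
        filter_upwards [sig_ae d] with v hv
        rw [← ENNReal.ofReal_one]
        refine ENNReal.ofReal_le_ofReal ?_
        have := abs_real_inner_le_norm v (baseVec d)
        rwa [hv, norm_baseVec, one_mul] at this
    _ < ∞ := by simp

lemma CC_pos (d : ℕ) : CC d ≠ 0 := by
  intro h
  rw [CC, lintegral_eq_zero_iff (by fun_prop)] at h
  have h1 : ∀ᵐ v ∂(sig d), ‖v‖ = 1 ∧ ⟪v, baseVec d⟫ = 0 := by
    filter_upwards [sig_ae d, h] with v hv h
    refine ⟨hv, ?_⟩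
    simpa using h
  have h2 : sig d {v | ‖v‖ = 1 ∧ ⟪v, baseVec d⟫ = 0} = 0 :=
    le_antisymm ((Measure.restrict_apply_le _ _).trans (sphere_null _ (norm_baseVec d)).le) zero_le
  have h3 : sig d univ = 0 := by
    have : (univ : Set (EE d)) ⊆ {v | ‖v‖ = 1 ∧ ⟪v, baseVec d⟫ = 0} ∪
      {v | ‖v‖ = 1 ∧ ⟪v, baseVec d⟫ = 0}ᶜ := by simp
    exact measure_mono_null this (measure_union_null h2 h1)
  rw [sig, Measure.restrict_apply_univ] at h3
  exact (sphere_pos d).ne' h3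

lemma NN_tendsto (d : ℕ) : Tendsto (fun k : ℕ => NN d (1 / ((k : ℝ) + 2))) atTop (𝓝 0) := by
  have hlim : Tendsto (fun k : ℕ => 1 / ((k : ℝ) + 2)) atTop (𝓝 0) := by
    have := tendsto_const_div_atTop_nhds_zero_nat (1 : ℝ) |>.comp (tendsto_add_atTop_nat 2)
    refine this.congr fun k => by simp
  have h := tendsto_measure_iInter_atTop (μ := sig d)
    (s := fun k : ℕ => {v : EE d | |⟪v, baseVec d⟫| < 1 / ((k : ℝ) + 2)})
    (fun k => (isOpen_lt (by fun_prop) (by fun_prop)).measurableSet.nullMeasurableSet)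
    (fun i j hij v hv => by
      refine lt_of_lt_of_le (mem_ofPred_eq ▸ hv) ?_
      have : (i : ℝ) ≤ j := by exact_mod_cast hij
      gcongr) ⟨0, measure_ne_top _ _⟩
  have h0 : sig d (⋂ k : ℕ, {v : EE d | |⟪v, baseVec d⟫| < 1 / ((k : ℝ) + 2)}) = 0 := by
    have h2 : sig d {v | ‖v‖ = 1 ∧ ⟪v, baseVec d⟫ = 0} = 0 :=
      le_antisymm ((Measure.restrict_apply_le _ _).trans (sphere_null _ (norm_baseVec d)).le)
        zero_le
    have h1 := sig_ae d
    rw [ae_iff] at h1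
    refine measure_mono_null ?_ (measure_union_null h2 h1)
    intro v hv
    rw [mem_iInter] at hv
    by_cases hn : ‖v‖ = 1
    · refine Or.inl ⟨hn, ?_⟩
      have : |⟪v, baseVec d⟫| ≤ 0 := ge_of_tendsto' hlim fun k => le_of_lt (hv k)
      exact abs_nonpos_iff.1 this
    · exact Or.inr hn
  rw [h0] at h
  exact h

lemma mS_apply {d : ℕ} {S : Set (EE d)} (hS : IsCompactSmoothHypersurface S)
    {B : Set (EE d)} (hB : MeasurableSet B) :
    mS S B = ∫⁻ v, ∫⁻ p : FF d, kap S (v, Jv v p) B ∂μH[(d : ℝ)] ∂(sig d) := by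
  have hk := measurable_kap hS.1
  rw [mS, Measure.bind_apply hB hk.aemeasurable]
  exact lintegral_kin ((Measure.measurable_coe hB).comp hk)

/-- Area measure on `S`. -/
def aS {d : ℕ} (S : Set (EE d)) : Measure (EE d) := (μH[(d : ℝ)]).restrict S

lemma aS_finite {d : ℕ} {S : Set (EE d)} (hS : IsCompactSmoothHypersurface S) :
    IsFiniteMeasure (aS S) :=
  ⟨by rw [aS, Measure.restrict_apply_univ]; exact hausdorff_lt_top hS⟩

lemma aS_closed {d : ℕ} {S : Set (EE d)} {K : Set (EE d)} (hK : MeasurableSet K) :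
    aS S K = μH[(d : ℝ)] (S ∩ K) := by
  rw [aS, Measure.restrict_apply hK, inter_comm]

lemma mS_le {d : ℕ} {S : Set (EE d)} (hS : IsCompactSmoothHypersurface S)
    {K : Set (EE d)} (hK : IsClosed K) : mS S K ≤ aS S K * sig d univ := by
  rw [mS_apply hS hK.measurableSet, aS_closed hK.measurableSet, ← lintegral_const]
  refine lintegral_mono_ae ?_
  filter_upwards [sig_ae d] with v hv
  exact lintegral_kap_le hS hv hK

lemma mS_finite {d : ℕ} {S : Set (EE d)} (hS : IsCompactSmoothHypersurface S) :
    IsFiniteMeasure (mS S) := by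
  have := aS_finite hS
  exact ⟨(mS_le hS isClosed_univ).trans_lt (ENNReal.mul_lt_top (measure_lt_top _ _)
    (measure_lt_top _ _))⟩

lemma mS_upper {d : ℕ} {S : Set (EE d)} (hS : IsCompactSmoothHypersurface S)
    {K : Set (EE d)} (hK : IsClosed K) {w : EE d} (hw : ‖w‖ = 1) {η s : ℝ}
    (hη : 0 < η) (hη1 : η ≤ 1) (hs : 0 < s) (hs1 : s ≤ 1 / 2)
    (hflat : ∀ y ∈ S ∩ K, ∀ z ∈ S ∩ K, |⟪y - z, w⟫| ≤ (s * η / 2) * ‖y - z‖) :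
    mS S K ≤ (ENNReal.ofReal (1 / (1 - s)) ^ (2 * d) * CC d + NN d η) * aS S K := by
  classical
  have hm : MeasurableSet {v : EE d | |⟪v, w⟫| < η} :=
    (isOpen_lt (by fun_prop) (by fun_prop)).measurableSet
  rw [mS_apply hS hK.measurableSet, aS_closed hK.measurableSet, ← CC_eq hw, ← NN_eq hw,
    ← lintegral_const_mul _ (by fun_prop), ← lintegral_indicator_one hm,
    ← lintegral_add_left (by fun_prop), ← lintegral_mul_const]
  swap
  · have h0 : Measurable fun v : EE d =>
        ENNReal.ofReal (1 / (1 - s)) ^ (2 * d) * ENNReal.ofReal |⟪v, w⟫| := by fun_prop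
    exact h0.add (measurable_one.indicator hm)
  refine lintegral_mono_ae ?_
  filter_upwards [sig_ae d] with v hv
  by_cases ha : η ≤ |⟪v, w⟫|
  · rw [lintegral_kap_inj hS hv hK (key_inj hv hw hη hη1 hs hs1 ha hflat)]
    refine (key_upper hv hw hη hη1 hs hs1 ha hflat).trans ?_
    rw [← mul_assoc]
    gcongr
    exact le_self_add
  · refine (lintegral_kap_le hS hv hK).trans ?_
    have : ({v : EE d | |⟪v, w⟫| < η}.indicator (1 : EE d → ℝ≥0∞)) v = 1 :=
      indicator_of_mem (show v ∈ {v : EE d | |⟪v, w⟫| < η} from not_le.1 ha) _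
    rw [this]
    exact le_mul_of_one_le_left' le_add_self

lemma mS_lower {d : ℕ} {S : Set (EE d)} (hS : IsCompactSmoothHypersurface S)
    {K : Set (EE d)} (hK : IsClosed K) {w : EE d} (hw : ‖w‖ = 1) {η s : ℝ}
    (hη : 0 < η) (hη1 : η ≤ 1) (hs : 0 < s) (hs1 : s ≤ 1 / 2)
    (hflat : ∀ y ∈ S ∩ K, ∀ z ∈ S ∩ K, |⟪y - z, w⟫| ≤ (s * η / 2) * ‖y - z‖) :
    CC d * aS S K ≤ ENNReal.ofReal (1 / (1 - s)) ^ (2 * d) * mS S K +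
      ENNReal.ofReal η * sig d univ * aS S K := by
  classical
  have e : ENNReal.ofReal η * sig d univ * aS S K =
      ∫⁻ v, ENNReal.ofReal η * aS S K ∂(sig d) := by
    rw [lintegral_const]; ring
  rw [e, mS_apply hS hK.measurableSet, aS_closed hK.measurableSet, ← CC_eq hw,
    ← lintegral_const_mul' _ _ (ENNReal.pow_ne_top ENNReal.ofReal_ne_top),
    ← lintegral_add_right _ measurable_const, ← lintegral_mul_const _ (by fun_prop)]
  refine lintegral_mono_ae ?_
  filter_upwards [sig_ae d] with v hv
  by_cases ha : η ≤ |⟪v, w⟫|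
  · rw [lintegral_kap_inj hS hv hK (key_inj hv hw hη hη1 hs hs1 ha hflat)]
    exact (key_lower hv hw hη hη1 hs hs1 ha hflat).trans le_self_add
  · refine le_trans ?_ le_add_self
    gcongr
    exact (not_le.1 ha).le

/-- Both inequalities, for all Borel subsets of `T`. -/
def Good {d : ℕ} (S : Set (EE d)) (α lam β : ℝ≥0∞) (T : Set (EE d)) : Prop :=
  ∀ B ⊆ T, MeasurableSet B → mS S B ≤ α * aS S B ∧ CC d * aS S B ≤ lam * mS S B + β * aS S B

lemma good_of_closed {d : ℕ} {S : Set (EE d)} (hS : IsCompactSmoothHypersurface S)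
    {α lam β : ℝ≥0∞} {U : Set (EE d)}
    (h : ∀ K ⊆ U, IsClosed K → mS S K ≤ α * aS S K ∧
      CC d * aS S K ≤ lam * mS S K + β * aS S K) : Good S α lam β U := by
  intro B hBU hB
  have := aS_finite hS
  have := mS_finite hS
  constructor
  · rw [hB.measure_eq_iSup_isClosed_of_ne_top (μ := mS S) (measure_ne_top _ _)]
    refine iSup_le fun K => iSup_le fun hKB => iSup_le fun hK => ?_
    refine (h K (hKB.trans hBU) hK).1.trans ?_
    gcongr
  · nth_rewrite 1 [hB.measure_eq_iSup_isClosed_of_ne_top (μ := aS S) (measure_ne_top _ _)]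
    simp_rw [ENNReal.mul_iSup]
    refine iSup_le fun K => iSup_le fun hKB => iSup_le fun hK => ?_
    refine (h K (hKB.trans hBU) hK).2.trans ?_
    gcongr

lemma good_all {d : ℕ} {S : Set (EE d)} (hS : IsCompactSmoothHypersurface S) {η s : ℝ}
    (hη : 0 < η) (hη1 : η ≤ 1) (hs : 0 < s) (hs1 : s ≤ 1 / 2) :
    ∃ T, MeasurableSet T ∧ S ⊆ T ∧
      Good S (ENNReal.ofReal (1 / (1 - s)) ^ (2 * d) * CC d + NN d η)
        (ENNReal.ofReal (1 / (1 - s)) ^ (2 * d)) (ENNReal.ofReal η * sig d univ) T := by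
  set α := ENNReal.ofReal (1 / (1 - s)) ^ (2 * d) * CC d + NN d η
  set lam := ENNReal.ofReal (1 / (1 - s)) ^ (2 * d)
  set β := ENNReal.ofReal η * sig d univ
  refine hS.1.induction_on (p := fun R => ∃ T, MeasurableSet T ∧ R ⊆ T ∧ Good S α lam β T)
    ?_ ?_ ?_ ?_
  · refine ⟨∅, MeasurableSet.empty, Subset.rfl, fun B hB _ => ?_⟩
    rw [subset_empty_iff.1 hB]
    simp
  · rintro R R' hR ⟨T, h1, h2, h3⟩
    exact ⟨T, h1, hR.trans h2, h3⟩
  · rintro R R' ⟨T, h1, h2, h3⟩ ⟨T', h1', h2', h3'⟩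
    refine ⟨T ∪ T', h1.union h1', union_subset_union h2 h2', fun B hB hBm => ?_⟩
    obtain ⟨u1, l1⟩ := h3 (B ∩ T) inter_subset_right (hBm.inter h1)
    obtain ⟨u2, l2⟩ := h3' (B \ T) (by
      rintro x ⟨hx, hn⟩
      exact (hB hx).resolve_left hn) (hBm.diff h1)
    rw [← measure_inter_add_sdiff (μ := mS S) B h1, ← measure_inter_add_sdiff (μ := aS S) B h1]
    constructor
    · rw [mul_add]; exact add_le_add u1 u2
    · rw [mul_add]
      refine (add_le_add l1 l2).trans (le_of_eq ?_)
      ring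
  · intro x hx
    obtain ⟨w, hw, U, hU, hxU, hfl⟩ := flat_local hS hx (ε := s * η / 2) (by positivity)
    refine ⟨U, mem_nhdsWithin_of_mem_nhds (hU.mem_nhds hxU), U, hU.measurableSet, Subset.rfl, ?_⟩
    refine good_of_closed hS fun K hKU hK => ?_
    have hflat : ∀ y ∈ S ∩ K, ∀ z ∈ S ∩ K, |⟪y - z, w⟫| ≤ (s * η / 2) * ‖y - z‖ :=
      fun y hy z hz => hfl y ⟨hy.1, hKU hy.2⟩ z ⟨hz.1, hKU hz.2⟩
    exact ⟨mS_upper hS hK hw hη hη1 hs hs1 hflat, mS_lower hS hK hw hη hη1 hs hs1 hflat⟩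

lemma mS_compl {d : ℕ} {S : Set (EE d)} (hS : IsCompactSmoothHypersurface S) : mS S Sᶜ = 0 := by
  rw [mS, Measure.bind_apply hS.1.measurableSet.compl (measurable_kap hS.1).aemeasurable]
  refine (lintegral_congr fun q => ?_).trans lintegral_zero
  unfold kap
  split_ifs
  · rw [Measure.restrict_apply hS.1.measurableSet.compl]
    have : Sᶜ ∩ (hits q ∩ S) = ∅ := by
      ext x; simp only [mem_inter_iff, mem_compl_iff, mem_empty_iff_false, iff_false]; tauto
    rw [this]; simp
  · rfl

/-- The Crofton formula. -/
theorem crofton {d : ℕ} {S : Set (EE d)} (hS : IsCompactSmoothHypersurface S) :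
    mS S = CC d • aS S := by
  have := aS_finite hS
  have := mS_finite hS
  ext B hB
  rw [Measure.smul_apply, smul_eq_mul]
  have em : mS S B = mS S (B ∩ S) := by
    have h0 : mS S (B \ S) = 0 := measure_mono_null (t := Sᶜ) (fun x hx => hx.2) (mS_compl hS)
    rw [← measure_inter_add_sdiff (μ := mS S) B hS.1.measurableSet, h0, add_zero]
  have ea : aS S B = aS S (B ∩ S) := by
    rw [aS, Measure.restrict_apply hB, Measure.restrict_apply (hB.inter hS.1.measurableSet),
      inter_assoc, inter_self]
  have key : ∀ k : ℕ, mS S B ≤ (ENNReal.ofReal (1 / (1 - 1 / ((k : ℝ) + 2))) ^ (2 * d) * CC d +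
        NN d (1 / ((k : ℝ) + 2))) * aS S B ∧
      CC d * aS S B ≤ ENNReal.ofReal (1 / (1 - 1 / ((k : ℝ) + 2))) ^ (2 * d) * mS S B +
        ENNReal.ofReal (1 / ((k : ℝ) + 2)) * sig d univ * aS S B := by
    intro k
    have hk : 1 / ((k : ℝ) + 2) ≤ 1 / 2 := by
      have : (0 : ℝ) ≤ k := Nat.cast_nonneg k
      gcongr; linarith
    have hk0 : 0 < 1 / ((k : ℝ) + 2) := by positivity
    obtain ⟨T, hT, hST, hG⟩ := good_all hS hk0 (hk.trans (by norm_num)) hk0 hk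
    rw [em, ea]
    exact hG _ (inter_subset_right.trans hST) (hB.inter hS.1.measurableSet)
  have hlim : Tendsto (fun k : ℕ => 1 / ((k : ℝ) + 2)) atTop (𝓝 0) := by
    have := tendsto_const_div_atTop_nhds_zero_nat (1 : ℝ) |>.comp (tendsto_add_atTop_nat 2)
    refine this.congr fun k => by simp
  have hl : Tendsto (fun k : ℕ => ENNReal.ofReal (1 / (1 - 1 / ((k : ℝ) + 2))) ^ (2 * d)) atTop
      (𝓝 1) := by
    have h1 : Tendsto (fun k : ℕ => 1 / (1 - 1 / ((k : ℝ) + 2))) atTop (𝓝 1) := by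
      have := (tendsto_const_nhds (x := (1 : ℝ))).div
        ((tendsto_const_nhds (x := (1 : ℝ))).sub hlim) (by norm_num)
      rw [sub_zero, div_one] at this
      exact this
    have h2 := (ENNReal.tendsto_ofReal h1)
    have h3 := ENNReal.Tendsto.pow (n := 2 * d) h2
    simpa using h3
  have hη : Tendsto (fun k : ℕ => ENNReal.ofReal (1 / ((k : ℝ) + 2))) atTop (𝓝 0) := by
    simpa using ENNReal.tendsto_ofReal hlim
  refine le_antisymm ?_ ?_
  · have h1 := ENNReal.Tendsto.mul_const (b := aS S B)
      ((ENNReal.Tendsto.mul_const (b := CC d) hl (Or.inl one_ne_zero)).add (NN_tendsto d))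
      (Or.inr (measure_ne_top _ _))
    rw [one_mul, add_zero] at h1
    exact ge_of_tendsto' h1 fun k => (key k).1
  · have h1 := (ENNReal.Tendsto.mul_const (b := mS S B) hl (Or.inl one_ne_zero)).add
      (ENNReal.Tendsto.mul_const (b := aS S B)
        (ENNReal.Tendsto.mul_const (b := sig d univ) hη (Or.inr (measure_ne_top _ _)))
        (Or.inr (measure_ne_top _ _)))
    rw [one_mul, zero_mul, zero_mul, add_zero] at h1
    exact ge_of_tendsto' h1 fun k => (key k).2

lemma integral_kap {d : ℕ} {S : Set (EE d)} (f : EE d → ℝ)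
    {q : EE d × EE d} (h1 : ‖q.1‖ = 1) (h2 : ⟪q.2, q.1⟫ = 0) :
    lineSum S f q.1 q.2 = ∫ x, f x ∂(kap S q) := by
  classical
  unfold lineSum kap
  rw [hits_line q h1 h2]
  split_ifs with h
  · have hfi : IntegrableOn f (h.toFinset : Set (EE d)) Measure.count := by
      have := (integrableOn_finite_biUnion (f := f) (μ := Measure.count) h
        (t := fun x : EE d => {x})).2 fun x _ => integrableOn_singleton (by simp) (by simp)
      rw [biUnion_of_singleton] at this
      rwa [h.coe_toFinset]
    have := setIntegral_finset h.toFinset hfi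
    rw [h.coe_toFinset] at this
    rw [this]
    simp
  · simp

lemma kap_zero {d : ℕ} {S : Set (EE d)} {r : ℝ} (hSr : S ⊆ ball 0 r) {q : EE d × EE d}
    (hq : ¬ ‖q.2‖ < r) : kap S q = 0 := by
  have : hits q ∩ S = ∅ := by
    ext x
    simp only [mem_inter_iff, mem_empty_iff_false, iff_false]
    rintro ⟨⟨h1, h2⟩, hx⟩
    have hx' : ‖x‖ < r := by simpa using hSr hx
    rw [← Jv_Pv _ h1] at h2
    have h3 := norm_Pv_le q.1 h1 x
    rw [h2, LinearIsometry.norm_map] at hq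
    exact hq (h3.trans_lt hx')
  unfold kap
  simp [this]

open scoped ProbabilityTheory in
lemma integral_lineSum {d : ℕ} {S : Set (EE d)} (hS : IsCompactSmoothHypersurface S)
    {r : ℝ} (hSr : S ⊆ ball 0 r) {f : EE d → ℝ} (hf : Continuous f) :
    ∫ q in {q : EE d × EE d | ‖q.2‖ < r}, lineSum S f q.1 q.2 ∂(kin d) =
      (CC d).toReal * ∫ x in S, f x ∂μH[(d : ℝ)] := by
  have hfin := aS_finite hS
  have e1 : ∫ q in {q : EE d × EE d | ‖q.2‖ < r}, lineSum S f q.1 q.2 ∂(kin d) =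
      ∫ q in {q : EE d × EE d | ‖q.2‖ < r}, ∫ x, f x ∂(kap S q) ∂(kin d) := by
    refine integral_congr_ae ?_
    filter_upwards [ae_restrict_of_ae (kin_ae d)] with q hq
    exact integral_kap f hq.1 hq.2
  rw [e1, setIntegral_eq_integral_of_forall_compl_eq_zero (fun q hq => by
    rw [kap_zero hSr hq, integral_zero_measure])]
  let κ : ProbabilityTheory.Kernel (EE d × EE d) (EE d) := ⟨kap S, measurable_kap hS.1⟩
  have hfi : Integrable f (aS S) := by
    obtain ⟨C, hC⟩ := hS.1.exists_bound_of_continuousOn hf.continuousOn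
    refine IntegrableOn.of_bound (hausdorff_lt_top hS) hf.aestronglyMeasurable C ?_
    filter_upwards [ae_restrict_mem hS.1.measurableSet] with x hx
    exact hC x hx
  have em : (κ ∘ₖ ProbabilityTheory.Kernel.const Unit (kin d)) () = mS S := by
    rw [← Measure.comp_eq_comp_const_apply]; rfl
  have hfi2 : Integrable f ((κ ∘ₖ ProbabilityTheory.Kernel.const Unit (kin d)) ()) := by
    rw [em, crofton hS]
    exact hfi.smul_measure (CC_lt_top d).ne
  have := ProbabilityTheory.Kernel.integral_comp hfi2
  rw [em, crofton hS, integral_smul_measure, ProbabilityTheory.Kernel.const_apply] at this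
  exact this.symm

lemma lineSum_one {n : ℕ} (S : Set (EuclideanSpace ℝ (Fin n))) (v p : EuclideanSpace ℝ (Fin n)) :
    ((lineThrough v p ∩ S).ncard : ℝ) = lineSum S (fun _ => 1) v p := by
  classical
  unfold lineSum
  split_ifs with h
  · rw [ncard_eq_toFinset_card _ h]; simp
  · rw [Set.Infinite.ncard h]; simp
/-- **Monte Carlo sampling of a hypersurface by equidistributed lines.** Let `Σ` be a compact
smooth hypersurface contained in the open ball of radius `r > 0` about the origin, with positive
area, and let `ℓᵢ = (vᵢ, pᵢ)` be a sequence of lines in `Lⁿ_r` (lines with `‖p‖ < r`) such that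
the averages of `f^Σ(ℓᵢ)` and of `#(ℓᵢ ∩ Σ)` converge to the corresponding mean values with
respect to kinematic measure on `Lⁿ_r`. Then the averages of `f` over the intersection points of
the first `m` lines with `Σ` converge to the area-average `(1/A(Σ)) ∫_Σ f dH^{n-1}`. -/
theorem point_cloud_equidistributed (n : ℕ) (hn : 2 ≤ n) (r : ℝ) (hr : 0 < r)
    (S : Set (EuclideanSpace ℝ (Fin n))) (hS : IsCompactSmoothHypersurface S)
    (hSr : S ⊆ ball (0 : EuclideanSpace ℝ (Fin n)) r)
    (hA : 0 < (μH[(n : ℝ) - 1] S).toReal)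
    (f : EuclideanSpace ℝ (Fin n) → ℝ) (hf : Continuous f)
    (ℓ : ℕ → EuclideanSpace ℝ (Fin n) × EuclideanSpace ℝ (Fin n))
    (hℓ : ∀ i, (ℓ i).1 ∈ sphere (0 : EuclideanSpace ℝ (Fin n)) 1 ∧
      ⟪(ℓ i).2, (ℓ i).1⟫ = 0 ∧ ‖(ℓ i).2‖ < r)
    (hmean₁ : Tendsto
      (fun m : ℕ => (∑ i ∈ Finset.range m, lineSum S f (ℓ i).1 (ℓ i).2) / m) atTop
      (𝓝 ((∫ q in {q : EuclideanSpace ℝ (Fin n) × EuclideanSpace ℝ (Fin n) | ‖q.2‖ < r},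
            lineSum S f q.1 q.2 ∂(kinematicMeasure n)) /
          ((kinematicMeasure n)
            {q : EuclideanSpace ℝ (Fin n) × EuclideanSpace ℝ (Fin n) | ‖q.2‖ < r}).toReal)))
    (hmean₂ : Tendsto
      (fun m : ℕ =>
        (∑ i ∈ Finset.range m, ((lineThrough (ℓ i).1 (ℓ i).2 ∩ S).ncard : ℝ)) / m) atTop
      (𝓝 ((∫ q in {q : EuclideanSpace ℝ (Fin n) × EuclideanSpace ℝ (Fin n) | ‖q.2‖ < r},
            ((lineThrough q.1 q.2 ∩ S).ncard : ℝ) ∂(kinematicMeasure n)) /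
          ((kinematicMeasure n)
            {q : EuclideanSpace ℝ (Fin n) × EuclideanSpace ℝ (Fin n) | ‖q.2‖ < r}).toReal))) :
    Tendsto
      (fun m : ℕ => (∑ i ∈ Finset.range m, lineSum S f (ℓ i).1 (ℓ i).2) /
        (∑ i ∈ Finset.range m, ((lineThrough (ℓ i).1 (ℓ i).2 ∩ S).ncard : ℝ))) atTop
      (𝓝 (((μH[(n : ℝ) - 1] S).toReal)⁻¹ * ∫ x in S, f x ∂(μH[(n : ℝ) - 1]))) := by
  obtain ⟨d, rfl⟩ : ∃ d, n = d + 1 := ⟨n - 1, by omega⟩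
  have hd : (((d + 1 : ℕ) : ℝ) - 1) = (d : ℝ) := by push_cast; ring
  rw [hd] at hA ⊢
  rw [kinematic_eq] at hmean₁ hmean₂
  simp only [lineSum_one] at hmean₂ ⊢
  rw [integral_lineSum (d := d) hS hSr hf] at hmean₁
  rw [integral_lineSum (d := d) hS hSr continuous_const] at hmean₂
  set M := (kin d {q | ‖q.2‖ < r}).toReal with hMdef
  have hM : 0 < M := by
    rw [hMdef, kin_ball]
    refine ENNReal.toReal_pos (mul_ne_zero ?_ (sphere_pos d).ne')
      (ENNReal.mul_ne_top measure_ball_lt_top.ne (sphere_lt_top d).ne)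
    exact (measure_ball_pos _ _ hr).ne'
  have hC : 0 < (CC d).toReal := ENNReal.toReal_pos (CC_pos d) (CC_lt_top d).ne
  have h1 : ∫ x in S, (1 : ℝ) ∂(μH[(d : ℝ)] : Measure (EE d)) = (μH[(d : ℝ)] S).toReal := by
    simp [Measure.real]
  rw [h1] at hmean₂
  have := hmean₁.div hmean₂ (by positivity)
  have hval : (CC d).toReal * (∫ x in S, f x ∂μH[(d : ℝ)]) / M /
      ((CC d).toReal * (μH[(d : ℝ)] S).toReal / M) =
      ((μH[(d : ℝ)] S).toReal)⁻¹ * ∫ x in S, f x ∂μH[(d : ℝ)] := by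
    field_simp
  rw [hval] at this
  refine this.congr' ?_
  filter_upwards [eventually_ne_atTop 0] with m hm
  have : (m : ℝ) ≠ 0 := by exact_mod_cast hm
  simp only [Pi.div_apply]
  exact div_div_div_cancel_right₀ this _ _
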